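/- arXiv:1412.0838 — 6 statements merged into one kernel-verified Lean document; each statement's English description precedes it below -/
import Mathlib

section
/- Let (Θ, μ) and (Z, ν) be σ-finite measure spaces. Let p : Θ → (0,∞) (prior density) and L : Θ → (0,∞) (likelihood) be measurable with 0 < ∫_Θ p·L dμ < ∞. Let g : Z × Θ → [0,∞) (augmented likelihood) and φ : Z → [0,∞) (weight function) be measurable, set G(θ) = ∫_Z g(z,θ) φ(z) dν(z), and assume 0 < ∫_Θ p·G dμ < ∞. Define the posterior density π(θ) = p(θ)L(θ)/∫_Θ p·L dμ and the augmented posterior density π₊(z,θ) = p(θ) g(z,θ) φ(z) / ∫_Θ p·G dμ. Then ∫_Z π₊(z,θ) dν(z) = π(θ) for μ-almost every θ if and only if there exists a constant c > 0 such that G(θ) = c·L(θ) for μ-almost every θ. -/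
open MeasureTheory

/-- Marginalization consistency of the augmented posterior: integrating the augmented
posterior density `π₊(z,θ) = p(θ) g(z,θ) φ(z) / ∫ p·G` over the augmentation variable `z`
recovers the ordinary posterior `π(θ) = p(θ)L(θ)/∫ p·L` (μ-a.e.) if and only if the
integrated augmented likelihood `G(θ) = ∫ g(z,θ) φ(z) dν(z)` is proportional to the
likelihood `L(θ)` (μ-a.e.), with a positive proportionality constant. -/
theorem augmented_posterior_consistency
    {Θ Z : Type*} [MeasurableSpace Θ] [MeasurableSpace Z]
    (μ : Measure Θ) (ν : Measure Z) [SigmaFinite μ] [SigmaFinite ν]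
    (p L : Θ → ℝ) (hpm : Measurable p) (hLm : Measurable L)
    (hppos : ∀ θ, 0 < p θ) (hLpos : ∀ θ, 0 < L θ)
    (hpL : Integrable (fun θ => p θ * L θ) μ)
    (hpLpos : 0 < ∫ θ, p θ * L θ ∂μ)
    (g : Z × Θ → ℝ) (hgm : Measurable g) (hgnn : ∀ q, 0 ≤ g q)
    (φ : Z → ℝ) (hφm : Measurable φ) (hφnn : ∀ z, 0 ≤ φ z)
    (G : Θ → ℝ) (hG : ∀ θ, G θ = ∫ z, g (z, θ) * φ z ∂ν)
    (hpG : Integrable (fun θ => p θ * G θ) μ)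
    (hpGpos : 0 < ∫ θ, p θ * G θ ∂μ)
    (π : Θ → ℝ) (hπ : ∀ θ, π θ = p θ * L θ / ∫ θ', p θ' * L θ' ∂μ)
    (πaug : Z × Θ → ℝ)
    (hπaug : ∀ z θ, πaug (z, θ) = p θ * g (z, θ) * φ z / ∫ θ', p θ' * G θ' ∂μ) :
    (∀ᵐ θ ∂μ, (∫ z, πaug (z, θ) ∂ν) = π θ) ↔
      ∃ c : ℝ, 0 < c ∧ ∀ᵐ θ ∂μ, G θ = c * L θ := by
  have key : ∀ θ, (∫ z, πaug (z, θ) ∂ν) = p θ * G θ / ∫ θ', p θ' * G θ' ∂μ := by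
    intro θ
    rw [hG θ, ← integral_const_mul, ← integral_div]
    refine integral_congr_ae (Filter.Eventually.of_forall fun z => ?_)
    simp only [hπaug, mul_assoc]
  simp only [key, hπ]
  constructor
  · intro h
    refine ⟨(∫ θ, p θ * G θ ∂μ) / ∫ θ, p θ * L θ ∂μ, div_pos hpGpos hpLpos, ?_⟩
    filter_upwards [h] with θ hθ
    rw [div_eq_div_iff hpGpos.ne' hpLpos.ne'] at hθ
    rw [div_mul_eq_mul_div, eq_div_iff hpLpos.ne']
    apply mul_left_cancel₀ (hppos θ).ne'
    linarith
  · rintro ⟨c, hc, h⟩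
    have hint : (∫ θ, p θ * G θ ∂μ) = c * ∫ θ, p θ * L θ ∂μ := by
      rw [← integral_const_mul]
      refine integral_congr_ae ?_
      filter_upwards [h] with θ hθ
      rw [hθ]
      ring
    filter_upwards [h] with θ hθ
    rw [div_eq_div_iff hpGpos.ne' hpLpos.ne', hint, hθ]
    ring
end

section
/- Let d ≥ 2, k ≥ 1, and let ψ = (p_{1:k}, μ_{1:k}, ν_{1:k}) be a Dirichlet mixture parameter with p_m > 0, Σ_m p_m = 1, μ_m ∈ interior(S_d), ν_m > 0. Let D ⊂ {1,…,d} be a set of retained coordinates with |D| = r, 1 ≤ r < d, and D_0 = {1,…,d} ∖ D the missing coordinates. For m = 1,…,k set ν_m^0 = ν_m (1 − Σ_{i∈D_0} μ_{i,m}), μ_{j,m}^0 = μ_{j,m} / (1 − Σ_{i∈D_0} μ_{i,m}) for j ∈ D, and p_m^0 = (d/r)(1 − Σ_{i∈D_0} μ_{i,m}) p_m. Then for every x ∈ (0,∞)^D: ∫_{(0,∞)^{D_0}} d · Σ_{m=1}^k [p_m Γ(ν_m)/∏_{j=1}^d Γ(ν_m μ_{j,m})] · (∏_{j∈D} x_j^{ν_m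 μ_{j,m} − 1}) (∏_{i∈D_0} z_i^{ν_m μ_{i,m} − 1}) · (Σ_{j∈D} x_j + Σ_{i∈D_0} z_i)^{−(ν_m+1)} dz = r · Σ_{m=1}^k [p_m^0 Γ(ν_m^0)/∏_{j∈D} Γ(ν_m^0 μ_{j,m}^0)] · (∏_{j∈D} x_j^{ν_m^0 μ_{j,m}^0 − 1}) · (Σ_{j∈D} x_j)^{−(ν_m^0 + 1)}. That is, the marginal of the Dirichlet-mixture exponent-measure density over missing directions is again of Dirichlet-mixture exponent-measure form in dimension r with parameters (p^0, μ^0, ν^0). -/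
open MeasureTheory Finset


lemma dm_lint {α : Type*} [MeasurableSpace α] {P : Measure α} {f : α → ℝ} {c : ℝ} (hc : 0 < c)
    (hf : 0 ≤ᵐ[P] f) (h : ∫ x, f x ∂P = c) :
    ∫⁻ x, ENNReal.ofReal (f x) ∂P = ENNReal.ofReal c := by
  have hi : Integrable f P := by
    apply Integrable.of_integral_ne_zero
    rw [h]; exact hc.ne'
  rw [← h, ofReal_integral_eq_lintegral_ofReal hi hf]

lemma dm_gamma {a r : ℝ} (ha : 0 < a) (hr : 0 < r) :
    ∫ t in Set.Ioi (0 : ℝ), t ^ (a - 1) * Real.exp (-(r * t)) = r ^ (-a) * Real.Gamma a := by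
  rw [Real.integral_rpow_mul_exp_neg_mul_Ioi ha hr, one_div, Real.inv_rpow hr.le,
    Real.rpow_neg hr.le]

lemma dm_gamma_lint {a r : ℝ} (ha : 0 < a) (hr : 0 < r) :
    ∫⁻ t in Set.Ioi (0 : ℝ), ENNReal.ofReal (t ^ (a - 1) * Real.exp (-(r * t)))
      = ENNReal.ofReal (r ^ (-a) * Real.Gamma a) := by
  apply dm_lint (mul_pos (Real.rpow_pos_of_pos hr _) (Real.Gamma_pos_of_pos ha)) _
    (dm_gamma ha hr)
  filter_upwards [ae_restrict_mem measurableSet_Ioi] with t ht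
  have : (0 : ℝ) < t := ht
  simp only [Pi.zero_apply]
  positivity

lemma dm_restrict {ι : Type*} [Fintype ι] :
    (volume : Measure (ι → ℝ)).restrict {z | ∀ i, 0 < z i}
      = Measure.pi (fun _ : ι => (volume : Measure ℝ).restrict (Set.Ioi 0)) := by
  rw [← Measure.restrict_pi_pi, volume_pi]
  congr 1
  ext z
  simp

lemma dm_meas {ι : Type*} [Fintype ι] : MeasurableSet {z : ι → ℝ | ∀ i, 0 < z i} := by
  have : {z : ι → ℝ | ∀ i, 0 < z i} = Set.univ.pi (fun _ => Set.Ioi 0) := by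
    ext z; simp
  rw [this]
  exact MeasurableSet.univ_pi (fun _ => measurableSet_Ioi)

lemma dm_inner {ι : Type*} [Fintype ι] (a : ι → ℝ) (ha : ∀ i, 0 < a i) {t : ℝ} (ht : 0 < t) :
    ∫⁻ z in {z : ι → ℝ | ∀ i, 0 < z i},
        ENNReal.ofReal (∏ i, (z i ^ (a i - 1) * Real.exp (-(t * z i))))
      = ENNReal.ofReal (∏ i, (t ^ (-a i) * Real.Gamma (a i))) := by
  apply dm_lint
  · exact Finset.prod_pos fun i _ =>
      mul_pos (Real.rpow_pos_of_pos ht _) (Real.Gamma_pos_of_pos (ha i))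
  · filter_upwards [ae_restrict_mem dm_meas] with z hz
    exact Finset.prod_nonneg fun i _ =>
      mul_nonneg (Real.rpow_nonneg (hz i).le _) (Real.exp_pos _).le
  · rw [dm_restrict, integral_fintype_prod_eq_prod
      (f := fun i (y : ℝ) => y ^ (a i - 1) * Real.exp (-(t * y)))]
    exact Finset.prod_congr rfl fun i _ => dm_gamma (ha i) ht

lemma dm_key {ι : Type*} [Fintype ι] (a : ι → ℝ) (ha : ∀ i, 0 < a i) {b s : ℝ} (hb : 0 < b)
    (hs : 0 < s) :
    ∫⁻ z in {z : ι → ℝ | ∀ i, 0 < z i},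
        ENNReal.ofReal ((∏ i, z i ^ (a i - 1)) *
          ((s + ∑ i, z i) ^ (-(b + ∑ i, a i)) * Real.Gamma (b + ∑ i, a i)))
      = ENNReal.ofReal ((∏ i, Real.Gamma (a i)) * (s ^ (-b) * Real.Gamma b)) := by
  have hA : 0 ≤ ∑ i, a i := Finset.sum_nonneg fun i _ => (ha i).le
  set c := b + ∑ i, a i with hc
  have hc0 : 0 < c := by linarith
  have h1 : ∀ z ∈ {z : ι → ℝ | ∀ i, 0 < z i},
      ENNReal.ofReal ((∏ i, z i ^ (a i - 1)) * ((s + ∑ i, z i) ^ (-c) * Real.Gamma c))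
      = ∫⁻ t in Set.Ioi (0 : ℝ), ENNReal.ofReal (t ^ (c - 1) * Real.exp (-(s * t))) *
          ENNReal.ofReal (∏ i, (z i ^ (a i - 1) * Real.exp (-(t * z i)))) := by
    intro z hz
    have hz' : ∀ i, 0 < z i := hz
    have hZ : 0 ≤ ∑ i, z i := Finset.sum_nonneg fun i _ => (hz' i).le
    have hP : 0 ≤ ∏ i, z i ^ (a i - 1) :=
      Finset.prod_nonneg fun i _ => Real.rpow_nonneg (hz' i).le _
    rw [ENNReal.ofReal_mul hP, ← dm_gamma_lint hc0 (by linarith),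
      ← lintegral_const_mul _ (by fun_prop)]
    refine setLIntegral_congr_fun measurableSet_Ioi fun t ht => ?_
    have ht' : (0 : ℝ) < t := ht
    rw [← ENNReal.ofReal_mul hP, ← ENNReal.ofReal_mul (by positivity)]
    congr 1
    rw [Finset.prod_mul_distrib, ← Real.exp_sum]
    have : Real.exp (-((s + ∑ i, z i) * t))
        = Real.exp (-(s * t)) * Real.exp (∑ i, -(t * z i)) := by
      rw [← Real.exp_add, Finset.sum_neg_distrib, ← Finset.mul_sum]
      congr 1; ring
    rw [this]; ring
  rw [setLIntegral_congr_fun dm_meas h1, lintegral_lintegral_swap (by fun_prop)]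
  have h2 : ∀ t ∈ Set.Ioi (0 : ℝ),
      ∫⁻ z in {z : ι → ℝ | ∀ i, 0 < z i},
        ENNReal.ofReal (t ^ (c - 1) * Real.exp (-(s * t))) *
          ENNReal.ofReal (∏ i, (z i ^ (a i - 1) * Real.exp (-(t * z i))))
      = ENNReal.ofReal (∏ i, Real.Gamma (a i)) *
          ENNReal.ofReal (t ^ (b - 1) * Real.exp (-(s * t))) := by
    intro t ht
    have ht' : (0 : ℝ) < t := ht
    rw [lintegral_const_mul _ (by fun_prop), dm_inner a ha ht',
      ← ENNReal.ofReal_mul (by positivity),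
      ← ENNReal.ofReal_mul (Finset.prod_nonneg fun i _ => (Real.Gamma_pos_of_pos (ha i)).le)]
    congr 1
    rw [Finset.prod_mul_distrib, ← Real.rpow_sum_of_pos ht']
    have : t ^ (b - 1) = t ^ (c - 1) * t ^ (∑ i, -a i) := by
      rw [← Real.rpow_add ht', Finset.sum_neg_distrib, hc]
      congr 1; ring
    rw [this]; ring
  rw [setLIntegral_congr_fun measurableSet_Ioi h2, lintegral_const_mul _ (by fun_prop),
    dm_gamma_lint hb hs,
    ← ENNReal.ofReal_mul (Finset.prod_nonneg fun i _ => (Real.Gamma_pos_of_pos (ha i)).le)]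

lemma dm_key_int {ι : Type*} [Fintype ι] (a : ι → ℝ) (ha : ∀ i, 0 < a i) {b s : ℝ} (hb : 0 < b)
    (hs : 0 < s) :
    IntegrableOn (fun z : ι → ℝ => (∏ i, z i ^ (a i - 1)) * (s + ∑ i, z i) ^ (-(b + ∑ i, a i)))
      {z | ∀ i, 0 < z i} ∧
    ∫ z in {z : ι → ℝ | ∀ i, 0 < z i},
        (∏ i, z i ^ (a i - 1)) * (s + ∑ i, z i) ^ (-(b + ∑ i, a i))
      = (∏ i, Real.Gamma (a i)) * (s ^ (-b) * Real.Gamma b) / Real.Gamma (b + ∑ i, a i) := by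
  have hA : 0 ≤ ∑ i, a i := Finset.sum_nonneg fun i _ => (ha i).le
  have hk := dm_key a ha hb hs
  have hG : 0 < Real.Gamma (b + ∑ i, a i) := Real.Gamma_pos_of_pos (by linarith)
  have hR : 0 < (∏ i, Real.Gamma (a i)) * (s ^ (-b) * Real.Gamma b) :=
    mul_pos (Finset.prod_pos fun i _ => Real.Gamma_pos_of_pos (ha i))
      (mul_pos (Real.rpow_pos_of_pos hs _) (Real.Gamma_pos_of_pos hb))
  have hnn : 0 ≤ᵐ[volume.restrict {z : ι → ℝ | ∀ i, 0 < z i}] fun z : ι → ℝ =>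
      ((∏ i, z i ^ (a i - 1)) *
          ((s + ∑ i, z i) ^ (-(b + ∑ i, a i)) * Real.Gamma (b + ∑ i, a i))) := by
    filter_upwards [ae_restrict_mem dm_meas] with z hz
    have hz' : ∀ i, 0 < z i := hz
    have hZ : 0 ≤ ∑ i, z i := Finset.sum_nonneg fun i _ => (hz' i).le
    exact mul_nonneg (Finset.prod_nonneg fun i _ => Real.rpow_nonneg (hz' i).le _)
      (mul_nonneg (Real.rpow_nonneg (by linarith) _) hG.le)
  have hI : ∫ z in {z : ι → ℝ | ∀ i, 0 < z i},
      ((∏ i, z i ^ (a i - 1)) *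
          ((s + ∑ i, z i) ^ (-(b + ∑ i, a i)) * Real.Gamma (b + ∑ i, a i)))
      = (∏ i, Real.Gamma (a i)) * (s ^ (-b) * Real.Gamma b) := by
    rw [integral_eq_lintegral_of_nonneg_ae hnn (by fun_prop), hk, ENNReal.toReal_ofReal hR.le]
  have hI2 : (∫ z in {z : ι → ℝ | ∀ i, 0 < z i},
        (∏ i, z i ^ (a i - 1)) * (s + ∑ i, z i) ^ (-(b + ∑ i, a i)))
      = (∏ i, Real.Gamma (a i)) * (s ^ (-b) * Real.Gamma b) / Real.Gamma (b + ∑ i, a i) := by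
    rw [eq_div_iff hG.ne', ← hI, ← integral_mul_const]
    simp only [mul_assoc]
  refine ⟨?_, hI2⟩
  apply Integrable.of_integral_ne_zero
  rw [hI2]
  exact (div_pos hR hG).ne'

/-- Marginalization of the Dirichlet-mixture exponent-measure density over the
directions `D₀ = Dᶜ` of missing components: integrating
`dλ_ψ/dx (x) = d Σ_m [p_m Γ(ν_m)/∏_j Γ(ν_m μ_{j,m})] ∏_j x_j^{ν_m μ_{j,m}−1} (Σ_j x_j)^{−(ν_m+1)}`
over `(0,∞)^{D₀}` yields again a Dirichlet-mixture exponent-measure density in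
dimension `r = |D|`, with marginalized parameters
`ν_m⁰ = ν_m(1 − Σ_{i∈D₀} μ_{i,m})`, `μ_{j,m}⁰ = μ_{j,m}/(1 − Σ_{i∈D₀} μ_{i,m})`,
`p_m⁰ = (d/r)(1 − Σ_{i∈D₀} μ_{i,m}) p_m`. -/
theorem dm_exponent_marginalization (d k : ℕ) (hd : 2 ≤ d) (hk : 1 ≤ k)
    (p : Fin k → ℝ) (hp : ∀ m, 0 < p m) (hps : ∑ m, p m = 1)
    (μ : Fin k → Fin d → ℝ) (hμ : ∀ m j, 0 < μ m j) (hμs : ∀ m, ∑ j, μ m j = 1)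
    (ν : Fin k → ℝ) (hν : ∀ m, 0 < ν m)
    (D : Finset (Fin d)) (hD : D.Nonempty) (hDu : D ≠ Finset.univ)
    (ν0 : Fin k → ℝ) (hν0 : ∀ m, ν0 m = ν m * (1 - ∑ i ∈ Dᶜ, μ m i))
    (μ0 : Fin k → Fin d → ℝ)
    (hμ0 : ∀ m, ∀ j ∈ D, μ0 m j = μ m j / (1 - ∑ i ∈ Dᶜ, μ m i))
    (p0 : Fin k → ℝ)
    (hp0 : ∀ m, p0 m = (d : ℝ) / (D.card : ℝ) * (1 - ∑ i ∈ Dᶜ, μ m i) * p m)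
    (x : Fin d → ℝ) (hx : ∀ j ∈ D, 0 < x j) :
    (∫ z in {z : {i : Fin d // i ∈ Dᶜ} → ℝ | ∀ i, 0 < z i},
        (d : ℝ) * ∑ m, p m * Real.Gamma (ν m) / (∏ j, Real.Gamma (ν m * μ m j))
          * (∏ j ∈ D, x j ^ (ν m * μ m j - 1))
          * (∏ i : {i : Fin d // i ∈ Dᶜ}, z i ^ (ν m * μ m (i : Fin d) - 1))
          * ((∑ j ∈ D, x j) + ∑ i, z i) ^ (-(ν m + 1)))
      = (D.card : ℝ) * ∑ m,
          p0 m * Real.Gamma (ν0 m) / (∏ j ∈ D, Real.Gamma (ν0 m * μ0 m j))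
            * (∏ j ∈ D, x j ^ (ν0 m * μ0 m j - 1))
            * (∑ j ∈ D, x j) ^ (-(ν0 m + 1)) := by
  have hs : 0 < ∑ j ∈ D, x j := Finset.sum_pos hx hD
  have hcard : (0 : ℝ) < D.card := by exact_mod_cast hD.card_pos
  have hsplit : ∀ m, ∑ j ∈ D, μ m j + ∑ i ∈ Dᶜ, μ m i = 1 := fun m => by
    rw [Finset.sum_add_sum_compl, hμs]
  have hq : ∀ m, 0 < 1 - ∑ i ∈ Dᶜ, μ m i := fun m => by
    have := Finset.sum_pos (fun j _ => hμ m j) hD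
    linarith [hsplit m]
  have hν0p : ∀ m, 0 < ν0 m := fun m => by
    rw [hν0]; exact mul_pos (hν m) (hq m)
  have hprod : ∀ m, ∀ j ∈ D, ν0 m * μ0 m j = ν m * μ m j := fun m j hj => by
    rw [hν0, hμ0 m j hj]
    have := (hq m).ne'
    field_simp
  have hsumeq : ∀ m, (ν0 m + 1) + ∑ i : {i : Fin d // i ∈ Dᶜ}, ν m * μ m (i : Fin d)
      = ν m + 1 := fun m => by
    rw [Finset.sum_coe_sort Dᶜ (fun i => ν m * μ m i), ← Finset.mul_sum, hν0]
    ring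
  have hkey := fun m => dm_key_int (fun i : {i : Fin d // i ∈ Dᶜ} => ν m * μ m (i : Fin d))
    (fun i => mul_pos (hν m) (hμ m i)) (b := ν0 m + 1) (by linarith [hν0p m]) hs
  simp only [hsumeq] at hkey
  rw [integral_const_mul]
  simp only [mul_assoc (_ * _ / _ * _)]
  rw [integral_finsetSum _ (fun m _ => (hkey m).1.const_mul _), Finset.mul_sum, Finset.mul_sum]
  refine Finset.sum_congr rfl fun m _ => ?_
  have e1 : ∏ j ∈ D, Real.Gamma (ν0 m * μ0 m j) = ∏ j ∈ D, Real.Gamma (ν m * μ m j) :=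
    Finset.prod_congr rfl (fun j hj => by rw [hprod m j hj])
  have e2 : ∏ j ∈ D, x j ^ (ν0 m * μ0 m j - 1) = ∏ j ∈ D, x j ^ (ν m * μ m j - 1) :=
    Finset.prod_congr rfl (fun j hj => by rw [hprod m j hj])
  rw [integral_const_mul, (hkey m).2, e1, e2,
    Real.Gamma_add_one (hν0p m).ne', Real.Gamma_add_one (hν m).ne',
    Finset.prod_coe_sort Dᶜ (fun i => Real.Gamma (ν m * μ m i)),
    ← Finset.prod_mul_prod_compl D (fun j => Real.Gamma (ν m * μ m j)), hp0]
  have h1 : ∏ j ∈ D, Real.Gamma (ν m * μ m j) ≠ 0 := Finset.prod_ne_zero_iff.mpr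
    fun j _ => (Real.Gamma_pos_of_pos (mul_pos (hν m) (hμ m j))).ne'
  have h2 : ∏ j ∈ Dᶜ, Real.Gamma (ν m * μ m j) ≠ 0 := Finset.prod_ne_zero_iff.mpr
    fun j _ => (Real.Gamma_pos_of_pos (mul_pos (hν m) (hμ m j))).ne'
  have h3 := (Real.Gamma_pos_of_pos (hν m)).ne'
  have h4 := (hν m).ne'
  generalize Real.Gamma (ν0 m) = G0
  generalize (∑ j ∈ D, x j) ^ (-(ν0 m + 1)) = S
  rw [hν0 m]
  generalize ∑ i ∈ Dᶜ, μ m i = q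
  field_simp
end

section
/- Let d ≥ 2, k ≥ 1, and let ψ = (p_{1:k}, μ_{1:k}, ν_{1:k}) satisfy p_m > 0, Σ_{m=1}^k p_m = 1, μ_m ∈ interior(S_d), and the moments constraint Σ_{m=1}^k p_m μ_m = (1/d, …, 1/d). Let D ⊂ {1,…,d} with |D| = r, 1 ≤ r < d, D_0 = {1,…,d} ∖ D, and define the marginalized parameters μ_{j,m}^0 = μ_{j,m}/(1 − Σ_{i∈D_0} μ_{i,m}) for j ∈ D and p_m^0 = (d/r)(1 − Σ_{i∈D_0} μ_{i,m}) p_m. Then: (i) p_m^0 > 0 for all m and Σ_{m=1}^k p_m^0 = 1; (ii) each μ_m^0 lies in the interior of the simplex S_r; and (iii) the marginalized parameters satisfy the moments constraint on S_r: Σ_{m=1}^k p_m^0 μ_{j,m}^0 = 1/r for every j ∈ D. -/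
open Finset

/-- The marginalized Dirichlet mixture parameters
`μ_{j,m}⁰ = μ_{j,m}/(1 − Σ_{i∈D₀} μ_{i,m})` (for `j ∈ D`) and
`p_m⁰ = (d/r)(1 − Σ_{i∈D₀} μ_{i,m}) p_m` (with `r = |D|`) of a Dirichlet mixture
parameter satisfying the moments constraint `Σ_m p_m μ_m = (1/d,…,1/d)` again form a
valid mixture parameter on the `r`-dimensional simplex: (i) the weights `p_m⁰` are
positive and sum to `1`; (ii) each center `μ_m⁰` lies in the interior of `S_r`;
(iii) the moments constraint holds on `S_r`: `Σ_m p_m⁰ μ_{j,m}⁰ = 1/r` for `j ∈ D`. -/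
theorem dm_marginalized_parameters (d k : ℕ) (hd : 2 ≤ d) (hk : 1 ≤ k)
    (p : Fin k → ℝ) (hp : ∀ m, 0 < p m) (hps : ∑ m, p m = 1)
    (μ : Fin k → Fin d → ℝ) (hμ : ∀ m j, 0 < μ m j) (hμs : ∀ m, ∑ j, μ m j = 1)
    (ν : Fin k → ℝ) (hν : ∀ m, 0 < ν m)
    (hmom : ∀ j, ∑ m, p m * μ m j = 1 / (d : ℝ))
    (D : Finset (Fin d)) (hD : D.Nonempty) (hDu : D ≠ Finset.univ)
    (μ0 : Fin k → Fin d → ℝ)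
    (hμ0 : ∀ m, ∀ j ∈ D, μ0 m j = μ m j / (1 - ∑ i ∈ Dᶜ, μ m i))
    (p0 : Fin k → ℝ)
    (hp0 : ∀ m, p0 m = (d : ℝ) / (D.card : ℝ) * (1 - ∑ i ∈ Dᶜ, μ m i) * p m) :
    ((∀ m, 0 < p0 m) ∧ ∑ m, p0 m = 1) ∧
    (∀ m, (∀ j ∈ D, 0 < μ0 m j) ∧ ∑ j ∈ D, μ0 m j = 1) ∧
    (∀ j ∈ D, ∑ m, p0 m * μ0 m j = 1 / (D.card : ℝ)) := by
  have hS : ∀ m, 1 - ∑ i ∈ Dᶜ, μ m i = ∑ i ∈ D, μ m i := by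
    intro m
    have h1 := Finset.sum_add_sum_compl D (μ m)
    rw [hμs m] at h1
    linarith
  have hpos : ∀ m, 0 < ∑ i ∈ D, μ m i := fun m => Finset.sum_pos (fun i _ => hμ m i) hD
  have hd0 : (0 : ℝ) < d := by
    have : 0 < d := by omega
    exact_mod_cast this
  have hr0 : (0 : ℝ) < (D.card : ℝ) := by exact_mod_cast hD.card_pos
  simp only [hS] at hμ0 hp0
  refine ⟨⟨fun m => ?_, ?_⟩, fun m => ⟨fun j hj => ?_, ?_⟩, fun j hj => ?_⟩
  · rw [hp0]
    exact mul_pos (mul_pos (div_pos hd0 hr0) (hpos m)) (hp m)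
  · have h2 : ∑ m, p0 m = (d : ℝ) / (D.card : ℝ) * ∑ j ∈ D, ∑ m, p m * μ m j := by
      rw [Finset.sum_comm, Finset.mul_sum]
      refine Finset.sum_congr rfl fun m _ => ?_
      rw [hp0, ← Finset.mul_sum]
      ring
    rw [h2, Finset.sum_congr rfl fun j _ => hmom j, Finset.sum_const, nsmul_eq_mul]
    field_simp
  · rw [hμ0 m j hj]
    exact div_pos (hμ m j) (hpos m)
  · rw [Finset.sum_congr rfl fun j hj => hμ0 m j hj, ← Finset.sum_div]
    exact div_self (hpos m).ne'
  · have h3 : ∑ m, p0 m * μ0 m j = (d : ℝ) / (D.card : ℝ) * ∑ m, p m * μ m j := by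
      rw [Finset.mul_sum]
      refine Finset.sum_congr rfl fun m _ => ?_
      rw [hp0, hμ0 m j hj]
      have := (hpos m).ne'
      field_simp
    rw [h3, hmom]
    field_simp
end

section
/- Let d ≥ 2, k ≥ 1, let p_m > 0, ν_m > 0, μ_m ∈ interior(S_d) for m = 1,…,k, fix a coordinate j and positive values x_r > 0 for r ≠ j, and set s = Σ_{r≠j} x_r, ρ_{j,m} = ∏_{r≠j} x_r^{ν_m μ_{r,m} − 1}, γ_m = Γ(ν_m)/∏_{r=1}^d Γ(ν_m μ_{r,m}), a_m = ν_m μ_{j,m}. Then for 0 ≤ L < R < ∞ and any bounded measurable g : (0,∞) → ℝ: ∫_L^R g(x_j) · Σ_{m=1}^k p_m γ_m ρ_{j,m} x_j^{a_m − 1} (s + x_j)^{−(ν_m + 1)} dx_j = Σ_{m=1}^k p_m γ_m ρ_{j,m} s^{a_m − ν_m − 1} ∫_{L/(s+L)}^{R/(s+R)} g(s u/(1−u)) u^{a_m − 1} (1 − u)^{ν_m (1 − μ_{j,m})} du. Consequently the full conditional distribution of the censored coordinate is a finite mixture, over m = 1,…,k, of the laws of s U_m/(1 − U_m) where U_m is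 a Beta(a_m, ν_m(1 − μ_{j,m}) + 1) random variable truncated to (L/(s+L), R/(s+R)). -/
open MeasureTheory Finset intervalIntegral


lemma aux_image (s L R : ℝ) (hs : 0 < s) (hL : 0 ≤ L) (hLR : L < R) :
    (fun t : ℝ => t / (s + t)) '' Set.Ioc L R = Set.Ioc (L / (s + L)) (R / (s + R)) := by
  have hR : 0 < R := by linarith
  ext u
  simp only [Set.mem_image, Set.mem_Ioc]
  constructor
  · rintro ⟨t, ⟨h1, h2⟩, rfl⟩
    have ht : 0 < t := by linarith
    rw [div_lt_div_iff₀ (by positivity) (by positivity),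
      div_le_div_iff₀ (by positivity) (by positivity)]
    constructor <;> nlinarith
  · rintro ⟨h1, h2⟩
    have hu1 : u < 1 := lt_of_le_of_lt h2 (by rw [div_lt_one (by positivity)]; linarith)
    have h3 : 0 < 1 - u := by linarith
    rw [div_lt_iff₀ (by positivity)] at h1
    rw [le_div_iff₀ (by positivity)] at h2
    refine ⟨s * u / (1 - u), ⟨?_, ?_⟩, ?_⟩
    · rw [lt_div_iff₀ h3]; nlinarith
    · rw [div_le_iff₀ h3]; nlinarith
    · have : s + s * u / (1 - u) = s / (1 - u) := by field_simp; ring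
      rw [this]; field_simp

lemma aux_cov (s L R a ν b : ℝ) (hs : 0 < s) (hL : 0 ≤ L) (hLR : L < R) (hb : b = ν - a)
    (g : ℝ → ℝ) :
    (∫ t in L..R, g t * (t ^ (a - 1) * (s + t) ^ (-(ν + 1)))) =
      s ^ (a - ν - 1) * ∫ u in (L / (s + L))..(R / (s + R)),
            g (s * u / (1 - u)) * (u ^ (a - 1) * (1 - u) ^ b) := by
  have hR : 0 < R := by linarith
  have hle : L / (s + L) ≤ R / (s + R) := by
    rw [div_le_div_iff₀ (by positivity) (by positivity)]; nlinarith
  rw [intervalIntegral.integral_of_le hLR.le, intervalIntegral.integral_of_le hle,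
    ← aux_image s L R hs hL hLR,
    integral_image_eq_integral_abs_deriv_smul (f' := fun t => s / (s + t) ^ 2)
      measurableSet_Ioc, ← MeasureTheory.integral_const_mul]
  · refine setIntegral_congr_fun measurableSet_Ioc ?_
    intro t ht
    have ht0 : 0 < t := by linarith [ht.1]
    have hst : 0 < s + t := by positivity
    have e1 : 1 - t / (s + t) = s / (s + t) := by field_simp; ring
    have e2 : s * (t / (s + t)) / (s / (s + t)) = t := by field_simp
    simp only [smul_eq_mul]
    rw [e1, e2, abs_of_pos (by positivity), Real.div_rpow ht0.le hst.le,
      Real.div_rpow hs.le hst.le, hb]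
    have k1 : s ^ (a - ν - 1) * s ^ (ν - a) * s = 1 := by
      rw [← Real.rpow_add hs, ← Real.rpow_add_one hs.ne']
      ring_nf
      exact Real.rpow_zero s
    have k2 : (s + t) ^ (-(ν + 1)) * ((s + t) ^ (a - 1) * (s + t) ^ (ν - a) * (s + t) ^ 2) = 1 := by
      rw [← Real.rpow_natCast (s + t) 2, ← Real.rpow_add hst, ← Real.rpow_add hst,
        ← Real.rpow_add hst]
      push_cast
      ring_nf
      exact Real.rpow_zero _
    rw [eq_div_of_mul_eq (by positivity) k2]
    have p1 : 0 < (s + t) ^ (a - 1) := by positivity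
    have p2 : 0 < (s + t) ^ (ν - a) := by positivity
    have : s ^ (a - ν - 1) * (s / (s + t) ^ 2 * (g t * (t ^ (a - 1) / (s + t) ^ (a - 1) *
        (s ^ (ν - a) / (s + t) ^ (ν - a))))) =
        (s ^ (a - ν - 1) * s ^ (ν - a) * s) * (g t * (t ^ (a - 1) *
          (1 / ((s + t) ^ (a - 1) * (s + t) ^ (ν - a) * (s + t) ^ 2)))) := by
      generalize (s + t) ^ (a - 1) = A at *
      generalize (s + t) ^ (ν - a) = B at *
      generalize s ^ (a - ν - 1) = D at *
      generalize s ^ (ν - a) = E at *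
      generalize t ^ (a - 1) = F at *
      field_simp
    rw [this, k1, one_mul]
  · intro t ht
    have ht0 : 0 < t := by linarith [ht.1]
    have hst : s + t ≠ 0 := by positivity
    have := ((hasDerivAt_id t).div ((hasDerivAt_id t).const_add s) hst)
    refine (this.congr_deriv ?_).hasDerivWithinAt
    simp
  · intro t ht t' ht' h
    have ht0 : 0 < t := by linarith [ht.1]
    have ht0' : 0 < t' := by linarith [ht'.1]
    simp only at h
    rw [div_eq_div_iff (by positivity) (by positivity)] at h
    have : s * (t - t') = 0 := by linarith
    rcases mul_eq_zero.1 this with h | h <;> linarith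

lemma aux_int (s L R a ν : ℝ) (hs : 0 < s) (hL : 0 ≤ L) (hLR : L < R) (ha : 0 < a)
    (g : ℝ → ℝ) (hg : Measurable g) (C : ℝ) (hgb : ∀ y, |g y| ≤ C) :
    IntervalIntegrable (fun t => g t * (t ^ (a - 1) * (s + t) ^ (-(ν + 1)))) volume L R := by
  have h1 : IntervalIntegrable (fun t : ℝ => t ^ (a - 1)) volume L R :=
    intervalIntegral.intervalIntegrable_rpow' (by linarith)
  have h2 : IntervalIntegrable (fun t : ℝ => t ^ (a - 1) * (s + t) ^ (-(ν + 1))) volume L R := by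
    refine h1.mul_continuousOn ?_
    refine ContinuousOn.rpow_const (by fun_prop) ?_
    intro t ht
    rw [Set.uIcc_of_le hLR.le] at ht
    left
    linarith [ht.1]
  rw [intervalIntegrable_iff] at h2 ⊢
  exact h2.bdd_mul (c := C) hg.aestronglyMeasurable (Filter.Eventually.of_forall hgb)

/-- The full conditional distribution of a censored coordinate `x_j` of an excess,
under a Dirichlet mixture exponent measure, is a finite mixture of transformed truncated
Beta laws: with `s = Σ_{r≠j} x_r`, `ρ_m = ∏_{r≠j} x_r^{ν_m μ_{r,m}−1}`,
`γ_m = Γ(ν_m)/∏_r Γ(ν_m μ_{r,m})` and `a_m = ν_m μ_{j,m}`,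
`∫_L^R g(x_j) Σ_m p_m γ_m ρ_m x_j^{a_m−1}(s+x_j)^{−(ν_m+1)} dx_j
  = Σ_m p_m γ_m ρ_m s^{a_m−ν_m−1}
      ∫_{L/(s+L)}^{R/(s+R)} g(su/(1−u)) u^{a_m−1}(1−u)^{ν_m(1−μ_{j,m})} du`. -/
theorem full_conditional_censored_coordinate_mixture (d k : ℕ) (hd : 2 ≤ d) (hk : 1 ≤ k)
    (p : Fin k → ℝ) (hp : ∀ m, 0 < p m)
    (ν : Fin k → ℝ) (hν : ∀ m, 0 < ν m)
    (μ : Fin k → Fin d → ℝ) (hμ : ∀ m r, 0 < μ m r) (hμs : ∀ m, ∑ r, μ m r = 1)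
    (j : Fin d) (x : Fin d → ℝ) (hx : ∀ r, r ≠ j → 0 < x r)
    (s : ℝ) (hsdef : s = ∑ r ∈ Finset.univ.erase j, x r)
    (ρ : Fin k → ℝ) (hρ : ∀ m, ρ m = ∏ r ∈ Finset.univ.erase j, x r ^ (ν m * μ m r - 1))
    (γ : Fin k → ℝ) (hγ : ∀ m, γ m = Real.Gamma (ν m) / ∏ r, Real.Gamma (ν m * μ m r))
    (a : Fin k → ℝ) (hadef : ∀ m, a m = ν m * μ m j)
    (L R : ℝ) (hL : 0 ≤ L) (hLR : L < R)
    (g : ℝ → ℝ) (hg : Measurable g) (C : ℝ) (hgb : ∀ y, |g y| ≤ C) :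
    (∫ t in L..R, g t * ∑ m, p m * γ m * ρ m * t ^ (a m - 1) * (s + t) ^ (-(ν m + 1)))
      = ∑ m, p m * γ m * ρ m * s ^ (a m - ν m - 1) *
          ∫ u in (L / (s + L))..(R / (s + R)),
            g (s * u / (1 - u)) * (u ^ (a m - 1) * (1 - u) ^ (ν m * (1 - μ m j))) := by
  have hs : 0 < s := by
    rw [hsdef]
    refine Finset.sum_pos (fun r hr => hx r (Finset.ne_of_mem_erase hr)) ?_
    rw [← Finset.card_pos, Finset.card_erase_of_mem (Finset.mem_univ j), Finset.card_univ,
      Fintype.card_fin]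
    omega
  have e : (fun t => g t * ∑ m, p m * γ m * ρ m * t ^ (a m - 1) * (s + t) ^ (-(ν m + 1))) =
      fun t => ∑ m, p m * γ m * ρ m * (g t * (t ^ (a m - 1) * (s + t) ^ (-(ν m + 1)))) := by
    funext t
    rw [Finset.mul_sum]
    exact Finset.sum_congr rfl fun m _ => by ring
  have ha : ∀ m, 0 < a m := fun m => by rw [hadef]; exact mul_pos (hν m) (hμ m j)
  rw [e, intervalIntegral.integral_finsetSum]
  · refine Finset.sum_congr rfl fun m _ => ?_
    rw [intervalIntegral.integral_const_mul,
      aux_cov s L R (a m) (ν m) (ν m * (1 - μ m j)) hs hL hLR (by rw [hadef]; ring) g]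
    ring
  · intro m _
    exact (aux_int s L R (a m) (ν m) hs hL hLR (ha m) g hg C hgb).const_mul _
end

section
/- Let d ≥ 1 and let h : S_d → [0,∞) be a measurable function on the unit simplex with ∫_{S_d} h(w) dw = c < ∞ (Lebesgue integration over the parametrization of S_d by its first d−1 coordinates). Define the measure λ on (0,∞)^d with Lebesgue density f(x) = d · ‖x‖_1^{−(d+1)} · h(x/‖x‖_1). Then for every r_0 > 0, λ({x ∈ (0,∞)^d : ‖x‖_1 > r_0}) = c · d / r_0. In particular, if h is a probability density on S_d then λ({‖x‖_1 > r_0}) = d/r_0. -/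
open MeasureTheory Finset

/-- The open parametrization domain `Δ = {(w_1,…,w_n) : w_i > 0, Σ w_i < 1}` of the unit
simplex `S_{n+1}` by its first `n` coordinates. -/
def openSimplexParam (n : ℕ) : Set (Fin n → ℝ) :=
  {w | (∀ i, 0 < w i) ∧ ∑ i, w i < 1}

/-- The embedding of the parametrization domain into the unit simplex `S_{n+1}`:
the last coordinate is `1 − Σ_{i<n} w_i`. -/
noncomputable def simplexEmbed {n : ℕ} (w : Fin n → ℝ) : Fin (n + 1) → ℝ :=
  Fin.snoc w (1 - ∑ i, w i)

lemma lintegral_scale_aux (n : ℕ) (G : (Fin n → ℝ) → ENNReal) (hG : Measurable G) (s : ℝ)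
    (hs : 0 < s) : ∫⁻ y, G y = ENNReal.ofReal (s ^ n) * ∫⁻ w, G (s • w) := by
  have h1 : ∫⁻ w, G (s • w) = ∫⁻ y, G y ∂(Measure.map (s • ·) volume) :=
    (lintegral_map hG (measurable_const_smul s)).symm
  rw [h1, Measure.map_addHaar_smul volume hs.ne', lintegral_smul_measure, smul_eq_mul,
    ← mul_assoc, ← ENNReal.ofReal_mul (by positivity), Module.finrank_fin_fun,
    abs_of_pos (by positivity), mul_inv_cancel₀ (by positivity)]
  simp

lemma measurable_snoc_aux (n : ℕ) :
    Measurable (fun p : ℝ × (Fin n → ℝ) => (Fin.snoc p.2 p.1 : Fin (n + 1) → ℝ)) := by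
  refine measurable_pi_iff.2 fun j => ?_
  refine Fin.lastCases ?_ (fun i => ?_) j
  · simpa using measurable_fst
  · simp only [Fin.snoc_castSucc]
    exact (measurable_pi_apply i).comp measurable_snd

lemma lintegral_shear_aux (n : ℕ) (F : (Fin (n + 1) → ℝ) → ENNReal) (hF : Measurable F) :
    ∫⁻ x, F x = ∫⁻ s : ℝ, ∫⁻ y : Fin n → ℝ, F (Fin.snoc y (s - ∑ i, y i)) := by
  have hm := measurable_snoc_aux n
  have e := (volume_preserving_piFinSuccAbove (fun _ : Fin (n + 1) => ℝ) (Fin.last n)).symm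
  have h1 : ∫⁻ x, F x = ∫⁻ p : ℝ × (Fin n → ℝ), F (Fin.snoc p.2 p.1) := by
    rw [← e.lintegral_comp hF]
    refine lintegral_congr fun p => ?_
    congr 1
    exact Fin.insertNth_last' p.1 p.2
  rw [h1, Measure.volume_eq_prod, lintegral_prod_symm' (fun p : ℝ × (Fin n → ℝ) => F (Fin.snoc p.2 p.1)) (hF.comp hm)]
  have h2 : ∀ y : Fin n → ℝ, ∫⁻ t : ℝ, F (Fin.snoc y t)
      = ∫⁻ s : ℝ, F (Fin.snoc y (s - ∑ i, y i)) := fun y =>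
    (lintegral_sub_right_eq_self (fun t : ℝ => F (Fin.snoc y t)) (∑ i, y i)).symm
  simp only [h2]
  refine lintegral_lintegral_swap (Measurable.aemeasurable ?_)
  have : Measurable (fun p : (Fin n → ℝ) × ℝ => ((p.2 - ∑ i, p.1 i, p.1) : ℝ × (Fin n → ℝ))) := by
    fun_prop
  exact hF.comp (hm.comp this)

/-- Radial mass of the exponent measure: if the angular function `h` on the unit simplex
`S_d` (with `d = n + 1 ≥ 1`) has total simplex integral `c < ∞`, then the measure `λ` on
`(0,∞)^d` with Lebesgue density `f(x) = d ‖x‖₁^{−(d+1)} h(x/‖x‖₁)` satisfies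
`λ({x : ‖x‖₁ > r₀}) = c·d/r₀` for every `r₀ > 0`. In particular, if `h` is a
probability density on `S_d`, then `λ({‖x‖₁ > r₀}) = d/r₀`. -/
theorem exponent_measure_radial_mass (n : ℕ)
    (h : (Fin (n + 1) → ℝ) → ℝ) (hmeas : Measurable h) (hnn : ∀ w, 0 ≤ h w)
    (c : ℝ)
    (hint : IntegrableOn (fun w => h (simplexEmbed w)) (openSimplexParam n))
    (hc : (∫ w in openSimplexParam n, h (simplexEmbed w)) = c)
    (r₀ : ℝ) (hr₀ : 0 < r₀) :
    (∫⁻ x in {x : Fin (n + 1) → ℝ | (∀ j, 0 < x j) ∧ r₀ < ∑ j, x j},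
        ENNReal.ofReal (((n : ℝ) + 1) * (∑ j, x j) ^ (-(((n : ℝ) + 1) + 1))
          * h (fun j => x j / ∑ i, x i)))
      = ENNReal.ofReal (c * ((n : ℝ) + 1) / r₀) := by
  set S : Set (Fin (n + 1) → ℝ) := {x | (∀ j, 0 < x j) ∧ r₀ < ∑ j, x j} with hS
  have hSm : MeasurableSet S := by
    have : S = (⋂ j, {x | 0 < x j}) ∩ {x | r₀ < ∑ j, x j} := by
      ext x; simp [hS]
    rw [this]
    refine (MeasurableSet.iInter fun j => measurableSet_lt measurable_const
      (measurable_pi_apply j)).inter (measurableSet_lt measurable_const (by fun_prop))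
  have hTm : MeasurableSet (openSimplexParam n) := by
    have : openSimplexParam n = (⋂ j, {x | 0 < x j}) ∩ {x | ∑ j, x j < 1} := by
      ext x; simp [openSimplexParam]
    rw [this]
    refine (MeasurableSet.iInter fun j => measurableSet_lt measurable_const
      (measurable_pi_apply j)).inter (measurableSet_lt (by fun_prop) measurable_const)
  have hC : ∫⁻ w in openSimplexParam n, ENNReal.ofReal (h (simplexEmbed w))
      = ENNReal.ofReal c := by
    rw [← hc, ofReal_integral_eq_lintegral_ofReal hint (ae_of_all _ fun w => hnn _)]
  rw [← lintegral_indicator hSm]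
  set f : (Fin (n + 1) → ℝ) → ENNReal := fun x =>
    ENNReal.ofReal (((n : ℝ) + 1) * (∑ j, x j) ^ (-(((n : ℝ) + 1) + 1))
          * h (fun j => x j / ∑ i, x i)) with hf
  have hfm : Measurable f := by
    have : Measurable (fun x : Fin (n + 1) → ℝ => (fun j => x j / ∑ i, x i : Fin (n + 1) → ℝ)) :=
      by fun_prop
    have h2 := hmeas.comp this
    refine Measurable.ennreal_ofReal (Measurable.mul ?_ h2)
    fun_prop
  have hFm : Measurable (S.indicator f) := hfm.indicator hSm
  rw [lintegral_shear_aux n _ hFm]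
  have hsum : ∀ (y : Fin n → ℝ) (s : ℝ),
      ∑ j, (Fin.snoc y (s - ∑ i, y i) : Fin (n + 1) → ℝ) j = s := by
    intro y s
    simp [Fin.sum_univ_castSucc]
  have key : ∀ s : ℝ, ∫⁻ y : Fin n → ℝ, S.indicator f (Fin.snoc y (s - ∑ i, y i))
      = (Set.Ioi r₀).indicator
        (fun s => ENNReal.ofReal (((n : ℝ) + 1) * s ^ (-2 : ℝ)) * ENNReal.ofReal c) s := by
    intro s
    by_cases hs : r₀ < s
    · have hs0 : 0 < s := hr₀.trans hs
      rw [Set.indicator_of_mem (show s ∈ Set.Ioi r₀ from hs)]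
      have hGm : Measurable fun y : Fin n → ℝ => S.indicator f (Fin.snoc y (s - ∑ i, y i)) := by
        have : Measurable (fun y : Fin n → ℝ => ((s - ∑ i, y i, y) : ℝ × (Fin n → ℝ))) := by
          fun_prop
        exact hFm.comp ((measurable_snoc_aux n).comp this)
      rw [lintegral_scale_aux n _ hGm s hs0]
      have hpt : ∀ w : Fin n → ℝ,
          S.indicator f (Fin.snoc (s • w) (s - ∑ i, (s • w) i))
          = (openSimplexParam n).indicator (fun w =>
            ENNReal.ofReal (((n : ℝ) + 1) * s ^ (-(((n : ℝ) + 1) + 1)))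
              * ENNReal.ofReal (h (simplexEmbed w))) w := by
        intro w
        have hmem : (Fin.snoc (s • w) (s - ∑ i, (s • w) i) : Fin (n + 1) → ℝ) ∈ S
            ↔ w ∈ openSimplexParam n := by
          rw [hS, Set.mem_ofPred_eq, hsum, Fin.forall_fin_succ']
          simp only [Fin.snoc_castSucc, Fin.snoc_last, Pi.smul_apply, smul_eq_mul,
            openSimplexParam, Set.mem_ofPred_eq, ← Finset.mul_sum, hs, and_true]
          refine and_congr (forall_congr' fun i => mul_pos_iff_of_pos_left hs0) ?_
          constructor
          · intro hh; nlinarith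
          · intro hh; nlinarith
        by_cases hw : w ∈ openSimplexParam n
        · rw [Set.indicator_of_mem hw, Set.indicator_of_mem (hmem.2 hw), hf]
          simp only [hsum]
          rw [← ENNReal.ofReal_mul (by positivity)]
          congr 3
          funext j
          refine Fin.lastCases ?_ (fun i => ?_) j
          · simp only [Fin.snoc_last, simplexEmbed, Pi.smul_apply, smul_eq_mul, ← Finset.mul_sum]
            field_simp
          · simp only [Fin.snoc_castSucc, simplexEmbed, Pi.smul_apply, smul_eq_mul]
            field_simp
        · rw [Set.indicator_of_notMem hw, Set.indicator_of_notMem (mt hmem.1 hw)]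
      simp only [hpt]
      rw [lintegral_indicator hTm, lintegral_const_mul' _ _ ENNReal.ofReal_ne_top, hC,
        ← mul_assoc, ← ENNReal.ofReal_mul (by positivity)]
      congr 2
      rw [mul_left_comm, ← Real.rpow_natCast, ← Real.rpow_add hs0]
      congr 2
      ring
    · rw [Set.indicator_of_notMem (show s ∉ Set.Ioi r₀ from hs)]
      rw [lintegral_eq_zero_iff' ]
      · refine ae_of_all _ fun y => ?_
        refine Set.indicator_of_notMem (fun hy => hs ?_) _
        have := hy.2
        rwa [hsum] at this
      · have : Measurable (fun y : Fin n → ℝ => ((s - ∑ i, y i, y) : ℝ × (Fin n → ℝ))) := by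
          fun_prop
        exact (hFm.comp ((measurable_snoc_aux n).comp this)).aemeasurable
  simp only [key]
  rw [lintegral_indicator measurableSet_Ioi, lintegral_mul_const' _ _ ENNReal.ofReal_ne_top]
  have hi : IntegrableOn (fun s : ℝ => ((n : ℝ) + 1) * s ^ (-2 : ℝ)) (Set.Ioi r₀) :=
    (integrableOn_Ioi_rpow_of_lt (by norm_num) hr₀).const_mul _
  rw [← ofReal_integral_eq_lintegral_ofReal hi, integral_const_mul,
    integral_Ioi_rpow_of_lt (by norm_num) hr₀, ← ENNReal.ofReal_mul]
  · congr 1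
    norm_num [Real.rpow_neg_one]
    ring
  · norm_num [Real.rpow_neg_one]
    positivity
  · refine (ae_restrict_iff' measurableSet_Ioi).2 (ae_of_all _ fun s hs => ?_)
    have : 0 < s := hr₀.trans hs
    simp only [Pi.zero_apply]
    positivity
end

section
/- Let σ > 0, 0 < ζ < 1, ξ ≠ 0, v ∈ ℝ, and define for y > v with 1 + ξ(y − v)/σ > 0 the generalized Pareto tail c.d.f. F(y) = 1 − ζ (1 + ξ(y − v)/σ)^{−1/ξ}, assumed to satisfy 0 < F(y) < 1, and the Fréchet transform T(y) = −1/log F(y). Then T is differentiable at y and its derivative satisfies T'(y) = σ^{−1} ζ^{−ξ} x² e^{1/x} (1 − e^{−1/x})^{1+ξ}, where x = T(y). -/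
/-- Jacobian of the Fréchet transform of the generalized Pareto tail: with
`F(y) = 1 − ζ(1 + ξ(y−v)/σ)^{−1/ξ}` and `T(y) = −1/log F(y)`, the transform `T` is
differentiable at `y` with `T'(y) = σ⁻¹ ζ^{−ξ} x² e^{1/x} (1 − e^{−1/x})^{1+ξ}`,
where `x = T(y)`. -/
theorem gpd_frechet_jacobian (σ ζ ξ v y : ℝ) (hσ : 0 < σ) (hζ0 : 0 < ζ) (hζ1 : ζ < 1)
    (hξ : ξ ≠ 0) (hy : v < y) (hpos : 0 < 1 + ξ * (y - v) / σ)
    (F T : ℝ → ℝ)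
    (hF : ∀ u, F u = 1 - ζ * (1 + ξ * (u - v) / σ) ^ (-1 / ξ))
    (hT : ∀ u, T u = -1 / Real.log (F u))
    (hF0 : 0 < F y) (hF1 : F y < 1) :
    HasDerivAt T
      (σ⁻¹ * ζ ^ (-ξ) * T y ^ 2 * Real.exp (1 / T y)
        * (1 - Real.exp (-1 / T y)) ^ (1 + ξ)) y := by
  have hw : HasDerivAt (fun u => 1 + ξ * (u - v) / σ) (ξ / σ) y := by
    have h := ((((hasDerivAt_id y).sub_const v).const_mul ξ).div_const σ).const_add 1
    simpa using h
  have hFd : HasDerivAt F (ζ / σ * (1 + ξ * (y - v) / σ) ^ (-1 / ξ - 1)) y := by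
    have h := ((hw.rpow_const (p := -1 / ξ) (Or.inl hpos.ne')).const_mul ζ).const_sub 1
    have hfe : F = fun u => 1 - ζ * (1 + ξ * (u - v) / σ) ^ (-1 / ξ) := funext hF
    rw [hfe]
    refine h.congr_deriv ?_
    field_simp
  have hlog : Real.log (F y) ≠ 0 := (Real.log_neg hF0 hF1).ne
  have hTd := (hasDerivAt_const y (-1 : ℝ)).div (hFd.log hF0.ne') hlog
  have hTe : T = fun u => -1 / Real.log (F u) := funext hT
  have h1 : 1 / T y = - Real.log (F y) := by
    rw [hT]; field_simp
  have h2 : -1 / T y = Real.log (F y) := by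
    rw [hT]; field_simp
  have h3 : 1 - F y = ζ * (1 + ξ * (y - v) / σ) ^ (-1 / ξ) := by
    rw [hF]; ring
  have h4 : (1 - F y) ^ (1 + ξ)
      = ζ * ζ ^ ξ * (1 + ξ * (y - v) / σ) ^ (-1 / ξ - 1) := by
    rw [h3, Real.mul_rpow hζ0.le (Real.rpow_nonneg hpos.le _), ← Real.rpow_mul hpos.le,
      Real.rpow_add hζ0, Real.rpow_one]
    congr 2
    field_simp
    ring
  rw [h1, h2, Real.exp_neg, Real.exp_log hF0, h4, hT y, Real.rpow_neg hζ0.le, hTe]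
  refine hTd.congr_deriv ?_
  have h5 : ζ ^ ξ ≠ 0 := (Real.rpow_pos_of_pos hζ0 _).ne'
  have h6 := hF0.ne'
  generalize (1 + ξ * (y - v) / σ) ^ (-1 / ξ - 1) = A
  generalize ζ ^ ξ = B at *
  generalize Real.log (F y) = L at *
  generalize F y = G at *
  field_simp
  try ring
end
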